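/- Fix q ∈ (0,1), t₁ ∈ ℤ≥0, p₁ ∈ ℤ, and define for N > t₁ the Laurent polynomial Q_N(w) = (q^{N−1};q^{−1})_{t₁} Σ_{k=0}^{N−t₁−1} [(q^{N−t₁−1};q^{−1})_{N−t₁−1−k} / (q^{N−1};q^{−1})_{N−t₁−1−k}] (w q^{−p₁})^{t₁+1+k}. Then for every w ∈ ℂ with 0 < |w| < q^{p₁}, one has lim_{N→∞} Q_N(w) = (w q^{−p₁})^{t₁+1} (q;q)_{t₁} / (w q^{−p₁};q)_{t₁+1}, and the convergence is uniform over w in compact subsets of {w : 0 < |w| < q^{p₁}}. -/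

import Mathlib

/-- `(a;q)_k = ∏_{i=0}^{k−1}(1 − a q^i)` for complex `a, q`. -/
noncomputable def qPochC (q a : ℂ) (k : ℕ) : ℂ := ∏ i ∈ Finset.range k, (1 - a * q ^ i)

/-- `(q^s;q^{−1})_k = ∏_{i=0}^{k−1}(1 − q^{s−i})` for an arbitrary integer `s`. -/
noncomputable def qPochCIntInv (q : ℂ) (s : ℤ) (k : ℕ) : ℂ :=
  ∏ i ∈ Finset.range k, (1 - q ^ (s - i))

/-- `Q_N(w) = (q^{N−1};q^{−1})_{t₁} Σ_{k=0}^{N−t₁−1}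
[(q^{N−t₁−1};q^{−1})_{N−t₁−1−k}/(q^{N−1};q^{−1})_{N−t₁−1−k}] (w q^{−p₁})^{t₁+1+k}`. -/
noncomputable def QN (q : ℂ) (t₁ : ℕ) (p₁ : ℤ) (N : ℕ) (w : ℂ) : ℂ :=
  qPochCIntInv q ((N : ℤ) - 1) t₁ *
    ∑ k ∈ Finset.range (N - t₁),
      (qPochCIntInv q ((N : ℤ) - t₁ - 1) (N - t₁ - 1 - k) /
          qPochCIntInv q ((N : ℤ) - 1) (N - t₁ - 1 - k)) *
        (w * q ^ (-p₁)) ^ (t₁ + 1 + k)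

/-- The limit `(w q^{−p₁})^{t₁+1} (q;q)_{t₁} / (w q^{−p₁};q)_{t₁+1}` of `Q_N`. -/
noncomputable def QLim (q : ℂ) (t₁ : ℕ) (p₁ : ℤ) (w : ℂ) : ℂ :=
  (w * q ^ (-p₁)) ^ (t₁ + 1) * qPochC q q t₁ / qPochC q (w * q ^ (-p₁)) (t₁ + 1)

theorem qPochC_zero (q a : ℂ) : qPochC q a 0 = 1 :=
  Finset.prod_range_zero _

theorem qPochC_succ (q a : ℂ) (k : ℕ) :
    qPochC q a (k + 1) = qPochC q a k * (1 - a * q ^ k) :=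
  Finset.prod_range_succ _ _

theorem qPochC_succ' (q a : ℂ) (k : ℕ) :
    qPochC q a (k + 1) = (1 - a) * qPochC q (q * a) k := by
  rw [qPochC, Finset.prod_range_succ', mul_comm, qPochC]
  congr 1
  · simp
  · exact Finset.prod_congr rfl fun i _ => by ring

theorem one_sub_mul_pow_ne_zero {q z : ℂ} (hq : ‖q‖ < 1) (hz : ‖z‖ < 1) (k : ℕ) :
    1 - z * q ^ k ≠ 0 := by
  intro h
  have h1 : ‖z * q ^ k‖ = 1 := by rw [← sub_eq_zero.1 h, norm_one]
  rw [norm_mul, norm_pow] at h1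
  have h2 : ‖q‖ ^ k ≤ 1 := pow_le_one₀ (norm_nonneg _) hq.le
  nlinarith [norm_nonneg z]

theorem qPochC_ne_zero {q z : ℂ} (hq : ‖q‖ < 1) (hz : ‖z‖ < 1) (k : ℕ) :
    qPochC q z k ≠ 0 :=
  Finset.prod_ne_zero_iff.2 fun i _ => one_sub_mul_pow_ne_zero hq hz i

theorem qPochCIntInv_mul_qPochC (q : ℂ) (a j : ℕ) :
    qPochCIntInv q ((a : ℤ) + j) j * qPochC q q a = qPochC q q (a + j) := by
  induction j with
  | zero => simp [qPochCIntInv]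
  | succ j ih =>
    have h : qPochCIntInv q ((a : ℤ) + (j + 1 : ℕ)) (j + 1) =
        qPochCIntInv q ((a : ℤ) + j) j * (1 - q * q ^ (a + j)) := by
      rw [qPochCIntInv, Finset.prod_range_succ', qPochCIntInv]
      congr 1
      · refine Finset.prod_congr rfl fun i _ => ?_
        rw [show (a : ℤ) + (j + 1 : ℕ) - (i + 1 : ℕ) = a + j - i by push_cast; ring]
      · rw [← pow_succ', ← zpow_natCast]
        congr 2
    rw [h, ← add_assoc, qPochC_succ, ← ih]
    ring

theorem qPochCIntInv_coeff {q : ℂ} (hq : ‖q‖ < 1) (t k m : ℕ) :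
    qPochCIntInv q ((t : ℤ) + k + m) t *
        (qPochCIntInv q ((k : ℤ) + m) m / qPochCIntInv q ((t : ℤ) + k + m) m) =
      qPochC q q (k + t) / qPochC q q k := by
  have h1 := qPochCIntInv_mul_qPochC q (k + m) t
  have h2 := qPochCIntInv_mul_qPochC q k m
  have h3 := qPochCIntInv_mul_qPochC q (t + k) m
  rw [show ((k + m : ℕ) : ℤ) + t = (t : ℤ) + k + m by push_cast; ring,
    show k + m + t = t + k + m by ring] at h1
  rw [Nat.cast_add] at h3
  have n1 := qPochC_ne_zero hq hq k
  have n2 := qPochC_ne_zero hq hq (k + m)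
  have n3 := qPochC_ne_zero hq hq (t + k + m)
  have n4 : qPochCIntInv q ((t : ℤ) + k + m) m ≠ 0 := by
    intro h
    rw [h, zero_mul] at h3
    exact n3 h3.symm
  rw [add_comm k t, ← mul_div_assoc, div_eq_div_iff n4 n1, mul_assoc, h2, h1, ← h3, mul_comm]

theorem norm_qPochC_div_le_one {q : ℝ} (hq0 : 0 < q) (hq1 : q < 1) (t k : ℕ) :
    ‖qPochC q q (k + t) / qPochC q q k‖ ≤ 1 := by
  induction t with
  | zero => simpa using div_self_le_one _
  | succ t ih =>
    rw [← add_assoc, qPochC_succ, mul_div_right_comm, norm_mul]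
    refine mul_le_one₀ ih (norm_nonneg _) ?_
    have h : (1 - (q : ℂ) * (q : ℂ) ^ (k + t)) = ((1 - q ^ (k + t + 1) : ℝ) : ℂ) := by
      push_cast
      ring
    have h1 : q ^ (k + t + 1) ≤ 1 := pow_le_one₀ hq0.le hq1.le
    have h2 : 0 < q ^ (k + t + 1) := pow_pos hq0 _
    rw [h, Complex.norm_real, Real.norm_eq_abs, abs_le]
    constructor <;> linarith

/-- The `q`-binomial series. -/
theorem hasSum_qPochC_div_mul_pow {q : ℂ} (hq : ‖q‖ < 1) (t : ℕ) :
    ∀ {z : ℂ}, ‖z‖ < 1 →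
      HasSum (fun k : ℕ => qPochC q q (k + t) / qPochC q q k * z ^ k)
        (qPochC q q t / qPochC q z (t + 1)) := by
  induction t with
  | zero =>
    intro z hz
    have h : ∀ k, qPochC q q k / qPochC q q k = 1 := fun k => div_self (qPochC_ne_zero hq hq k)
    have h1 : qPochC q z 1 = 1 - z := by simp [qPochC]
    simpa [h, h1, qPochC_zero] using hasSum_geometric_of_norm_lt_one hz
  | succ t ih =>
    intro z hz
    have hqz : ‖q * z‖ < 1 := by
      rw [norm_mul]
      nlinarith [norm_nonneg q, norm_nonneg z]
    have hterm : ∀ k, qPochC q q (k + (t + 1)) / qPochC q q k * z ^ k =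
        qPochC q q (k + t) / qPochC q q k * z ^ k -
          q ^ (t + 1) * (qPochC q q (k + t) / qPochC q q k * (q * z) ^ k) := fun k => by
      rw [← add_assoc, qPochC_succ]
      ring
    have hval : qPochC q q (t + 1) / qPochC q z (t + 1 + 1) = qPochC q q t / qPochC q z (t + 1) -
        q ^ (t + 1) * (qPochC q q t / qPochC q (q * z) (t + 1)) := by
      have n1 := qPochC_ne_zero hq hqz t
      have n2 : 1 - z ≠ 0 := by simpa using one_sub_mul_pow_ne_zero hq hz 0
      have n3 := one_sub_mul_pow_ne_zero hq hz (t + 1)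
      rw [qPochC_succ, qPochC_succ' q z (t + 1), qPochC_succ' q z t, qPochC_succ q (q * z) t,
        show q * z * q ^ t = z * q ^ (t + 1) by ring]
      field_simp
      ring
    simp only [hterm, hval]
    exact (ih hz).sub ((ih hqz).mul_left (q ^ (t + 1)))

theorem QN_eq_sum {q : ℂ} (hq : ‖q‖ < 1) (t : ℕ) (p : ℤ) (N : ℕ) (w : ℂ) :
    QN q t p N w = ∑ k ∈ Finset.range (N - t),
      qPochC q q (k + t) / qPochC q q k * (w * q ^ (-p)) ^ (t + 1 + k) := by
  rw [QN, Finset.mul_sum]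
  refine Finset.sum_congr rfl fun k hk => ?_
  obtain ⟨m, rfl⟩ : ∃ m, N = t + k + m + 1 :=
    ⟨N - t - k - 1, by have := Finset.mem_range.1 hk; omega⟩
  rw [← mul_assoc, ← qPochCIntInv_coeff hq t k m,
    show t + k + m + 1 - t - 1 - k = m by omega]
  congr 4 <;> push_cast <;> ring_nf

theorem tendstoUniformlyOn_QN {q : ℝ} (hq0 : 0 < q) (hq1 : q < 1) (t : ℕ) (p : ℤ) {K : Set ℂ}
    (hK : IsCompact K) (hKq : ∀ w ∈ K, ‖w‖ < q ^ p) :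
    TendstoUniformlyOn (fun N : ℕ => QN (q : ℂ) t p N) (QLim (q : ℂ) t p) Filter.atTop K := by
  have hq : ‖(q : ℂ)‖ < 1 := by rwa [Complex.norm_real, Real.norm_of_nonneg hq0.le]
  rcases K.eq_empty_or_nonempty with rfl | hne
  · exact tendstoUniformlyOn_empty
  have hz : ∀ w ∈ K, ‖w * (q : ℂ) ^ (-p)‖ < 1 := fun w hw => by
    rw [norm_mul, norm_zpow, Complex.norm_real, Real.norm_of_nonneg hq0.le, zpow_neg,
      ← div_eq_mul_inv, div_lt_one (zpow_pos hq0 p)]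
    exact hKq w hw
  obtain ⟨w₀, hw₀, hmax⟩ := hK.exists_isMaxOn hne
    (f := fun w : ℂ => ‖w * (q : ℂ) ^ (-p)‖) (by fun_prop)
  have hM := tendstoUniformlyOn_tsum_nat
    (f := fun k w => qPochC q q (k + t) / qPochC q q k * (w * (q : ℂ) ^ (-p)) ^ (t + 1 + k))
    (s := K) (summable_geometric_of_lt_one (norm_nonneg _) (hz w₀ hw₀)) fun k w hw => by
      rw [norm_mul, norm_pow, pow_add]
      calc _ ≤ 1 * (1 * ‖w * (q : ℂ) ^ (-p)‖ ^ k) := by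
            gcongr
            · exact norm_qPochC_div_le_one hq0 hq1 t k
            · exact pow_le_one₀ (norm_nonneg _) (hz w hw).le
        _ ≤ _ := by
            rw [one_mul, one_mul]
            exact pow_le_pow_left₀ (norm_nonneg _) (hmax hw) k
  have hN : TendstoUniformlyOn (fun N : ℕ => QN (q : ℂ) t p N)
      (fun w => ∑' k, qPochC q q (k + t) / qPochC q q k * (w * (q : ℂ) ^ (-p)) ^ (t + 1 + k))
      Filter.atTop K := by
    rw [funext fun N => funext (QN_eq_sum hq t p N)]
    exact fun u hu => (Filter.tendsto_sub_atTop_nat t).eventually (hM u hu)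
  refine hN.congr_right fun w hw => ?_
  convert ((hasSum_qPochC_div_mul_pow hq t (hz w hw)).mul_left
    ((w * (q : ℂ) ^ (-p)) ^ (t + 1))).tsum_eq using 1
  · exact tsum_congr fun k => by ring
  · rw [QLim, mul_div_assoc]

/-- `Q_N(w) → (wq^{−p₁})^{t₁+1}(q;q)_{t₁}/(wq^{−p₁};q)_{t₁+1}` as `N → ∞`, for
`0 < |w| < q^{p₁}`, uniformly on compact subsets of that annulus. -/
theorem stmt_8 (q : ℝ) (hq0 : 0 < q) (hq1 : q < 1) (t₁ : ℕ) (p₁ : ℤ) :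
    (∀ w : ℂ, 0 < ‖w‖ → ‖w‖ < q ^ p₁ →
      Filter.Tendsto (fun N : ℕ => QN (q : ℂ) t₁ p₁ N w) Filter.atTop
        (nhds (QLim (q : ℂ) t₁ p₁ w))) ∧
    ∀ K : Set ℂ, IsCompact K → K ⊆ {w : ℂ | 0 < ‖w‖ ∧ ‖w‖ < q ^ p₁} →
      TendstoUniformlyOn (fun N : ℕ => QN (q : ℂ) t₁ p₁ N) (QLim (q : ℂ) t₁ p₁)
        Filter.atTop K := by
  refine ⟨fun w _ hw => ?_, fun K hK hKq => tendstoUniformlyOn_QN hq0 hq1 t₁ p₁ hK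
    fun w hw => (hKq hw).2⟩
  exact (tendstoUniformlyOn_QN hq0 hq1 t₁ p₁ (isCompact_singleton (x := w))
    (by rintro _ rfl; exact hw)).tendsto_at rfl
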